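/- Let 1 ≤ k ≤ n and t ∈ ℂ with t ≠ 0. A k-dimensional ℂ-linear subspace V of ℂⁿ satisfies σ_t(V) = V if and only if V = V_S for some set S of k distinct complex numbers with z^n = (−1)^{k−1}t for every z ∈ S; moreover, the number of k-dimensional subspaces V with σ_t(V) = V is exactly the binomial coefficient C(n,k). -/

import Mathlib

open scoped BigOperators

/-- The `t`-deformed left cyclic shift map on `ℂⁿ`:
`σ_t(v₁,…,vₙ) = (v₂,…,vₙ,(−1)^{k−1} t v₁)`. -/
noncomputable def cycShift (k n : ℕ) (t : ℂ) : (Fin n → ℂ) →ₗ[ℂ] (Fin n → ℂ) where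
  toFun v := fun i =>
    if h : (i : ℕ) + 1 < n then v ⟨(i : ℕ) + 1, h⟩ else (-1 : ℂ) ^ (k - 1) * t * v ⟨0, i.pos⟩
  map_add' u v := by
    funext i
    by_cases h : (i : ℕ) + 1 < n <;> simp [h, mul_add]
  map_smul' c v := by
    funext i
    by_cases h : (i : ℕ) + 1 < n <;> simp [h, mul_comm, mul_left_comm, mul_assoc]

/-- `V_S`: the span in `ℂⁿ` of the vectors `(1, z, …, z^{n-1})` for `z ∈ S`. -/
noncomputable def VS (n : ℕ) (S : Finset ℂ) : Submodule ℂ (Fin n → ℂ) :=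
  Submodule.span ℂ ((fun z : ℂ => fun j : Fin n => z ^ (j : ℕ)) '' (S : Set ℂ))

/-- `S₀`: the `k` n-th roots of `(−1)^{k−1}` closest to `1` on the unit circle. -/
noncomputable def S0 (k n : ℕ) : Finset ℂ :=
  Finset.image
    (fun j : Fin k => Complex.exp (Complex.I * ((2 * (j : ℝ) + 1 - k) * Real.pi / n)))
    Finset.univ

/-- The rows of a real `k × n` matrix, viewed as vectors in `ℂⁿ`. -/
def rowsC {k n : ℕ} (A : Matrix (Fin k) (Fin n) ℝ) : Fin k → (Fin n → ℂ) :=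
  fun p j => (A p j : ℂ)

/-- A subspace `V ⊆ ℂⁿ` is totally nonnegative if it has a basis given by the rows
of a real `k × n` matrix all of whose `k × k` minors (columns in increasing order)
are nonnegative. -/
def IsTotallyNonneg (k n : ℕ) (V : Submodule ℂ (Fin n → ℂ)) : Prop :=
  ∃ A : Matrix (Fin k) (Fin n) ℝ,
    LinearIndependent ℂ (rowsC A) ∧
    Submodule.span ℂ (Set.range (rowsC A)) = V ∧
    ∀ g : Fin k → Fin n, StrictMono g → 0 ≤ (A.submatrix id g).det

/-- Totally positive subspaces: as above but with strictly positive minors. -/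
def IsTotallyPos (k n : ℕ) (V : Submodule ℂ (Fin n → ℂ)) : Prop :=
  ∃ A : Matrix (Fin k) (Fin n) ℝ,
    LinearIndependent ℂ (rowsC A) ∧
    Submodule.span ℂ (Set.range (rowsC A)) = V ∧
    ∀ g : Fin k → Fin n, StrictMono g → 0 < (A.submatrix id g).det

/-- The vector `(1, z, …, z^{n-1})`. -/
def powVec (n : ℕ) (z : ℂ) : Fin n → ℂ := fun j => z ^ (j : ℕ)

theorem powVec_ne_zero {n : ℕ} (hn : 0 < n) (z : ℂ) : powVec n z ≠ 0 := fun h => by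
  simpa [powVec] using congrFun h ⟨0, hn⟩

theorem VS_eq_span (n : ℕ) (S : Finset ℂ) :
    VS n S = Submodule.span ℂ (powVec n '' (S : Set ℂ)) := rfl

theorem cycShift_powVec {k n : ℕ} {t z : ℂ} (hz : z ^ n = (-1 : ℂ) ^ (k - 1) * t) :
    cycShift k n t (powVec n z) = z • powVec n z := by
  funext i
  by_cases h : (i : ℕ) + 1 < n
  · simp [cycShift, powVec, h, pow_succ']
  · have hi : (i : ℕ) + 1 = n := by omega
    simp [cycShift, powVec, ← hz, ← pow_succ', hi]

theorem card_nthRootsFinset_of_ne_zero {n : ℕ} (hn : 0 < n) {c : ℂ} (hc : c ≠ 0) :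
    (Polynomial.nthRootsFinset n c).card = n := by
  have hsep : (Polynomial.X ^ n - Polynomial.C c).Separable :=
    Polynomial.separable_X_pow_sub_C c (Nat.cast_ne_zero.mpr hn.ne') hc
  rw [Polynomial.nthRootsFinset_def, Polynomial.nthRoots,
    Multiset.toFinset_card_of_nodup (Polynomial.nodup_roots hsep),
    ← (IsAlgClosed.splits _).natDegree_eq_card_roots, Polynomial.natDegree_X_pow_sub_C]

theorem linearIndepOn_powVec {k n : ℕ} (hn : 0 < n) {t : ℂ} {s : Set ℂ}
    (hs : ∀ z ∈ s, z ^ n = (-1 : ℂ) ^ (k - 1) * t) : LinearIndepOn ℂ (powVec n) s :=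
  Module.End.eigenvectors_linearIndependent (cycShift k n t) s (fun z => powVec n z) fun z =>
    ⟨Module.End.mem_eigenspace_iff.mpr (cycShift_powVec (hs z z.2)), powVec_ne_zero hn z⟩

/-- The components of a vector along eigenvectors with distinct eigenvalues lie in any invariant
subspace containing the vector. -/
theorem smul_mem_of_sum_smul_mem {K M : Type*} [Field K] [AddCommGroup M] [Module K M]
    {f : Module.End K M} {V : Submodule K M} (hV : V ≤ V.comap f) {R : Finset K} {e : K → M}
    (he : ∀ z ∈ R, f (e z) = z • e z) {a : K → K} (hv : ∑ z ∈ R, a z • e z ∈ V)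
    {w : K} (hw : w ∈ R) : a w • e w ∈ V := by
  classical
  have key := Polynomial.aeval_apply_smul_mem_of_le_comap hv (Lagrange.basis R id w) f hV
  rw [map_sum, Finset.sum_eq_single_of_mem w hw] at key
  · have h1 : (Lagrange.basis R id w).eval w = 1 :=
      Lagrange.eval_basis_self (v := id) (Set.injOn_id _) hw
    rwa [map_smul, Module.End.aeval_apply_of_mem_apply_eq_smul (he w hw), h1, one_smul] at key
  · intro z hz hzw
    have h0 : (Lagrange.basis R id w).eval z = 0 :=
      Lagrange.eval_basis_of_ne (v := id) hzw.symm hz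
    rw [map_smul, Module.End.aeval_apply_of_mem_apply_eq_smul (he z hz), h0, zero_smul, smul_zero]

section

variable {k n : ℕ} {t : ℂ}

theorem finrank_VS (hn : 0 < n) {S : Finset ℂ} (hS : ∀ z ∈ S, z ^ n = (-1 : ℂ) ^ (k - 1) * t) :
    Module.finrank ℂ (VS n S) = S.card := by
  have h := finrank_span_eq_card (linearIndepOn_powVec hn hS : LinearIndependent ℂ _)
  rw [VS_eq_span, Set.image_eq_range]
  exact h.trans (by simp)

theorem map_cycShift_VS (hn : 0 < n) (ht : t ≠ 0) {S : Finset ℂ}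
    (hS : ∀ z ∈ S, z ^ n = (-1 : ℂ) ^ (k - 1) * t) :
    Submodule.map (cycShift k n t) (VS n S) = VS n S := by
  have hmem : ∀ z ∈ S, powVec n z ∈ VS n S := fun z hz =>
    Submodule.subset_span (Set.mem_image_of_mem _ hz)
  apply le_antisymm
  · rw [VS_eq_span, Submodule.map_span_le]
    rintro _ ⟨z, hz, rfl⟩
    rw [cycShift_powVec (hS z hz)]
    exact Submodule.smul_mem _ _ (hmem z hz)
  · conv_lhs => rw [VS_eq_span]
    rw [Submodule.span_le]
    rintro _ ⟨z, hz, rfl⟩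
    have hz0 : z ≠ 0 := by
      rintro rfl
      simpa [hn.ne', ht] using hS 0 hz
    refine ⟨z⁻¹ • powVec n z, Submodule.smul_mem _ _ (hmem z hz), ?_⟩
    rw [map_smul, cycShift_powVec (hS z hz), inv_smul_smul₀ hz0]

theorem VS_injOn (hn : 0 < n) :
    Set.InjOn (VS n) {S : Finset ℂ | ∀ z ∈ S, z ^ n = (-1 : ℂ) ^ (k - 1) * t} := by
  have sub : ∀ S T : Finset ℂ, (∀ z ∈ S, z ^ n = (-1 : ℂ) ^ (k - 1) * t) →
      (∀ z ∈ T, z ^ n = (-1 : ℂ) ^ (k - 1) * t) → VS n S = VS n T → S ⊆ T := by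
    intro S T hS hT h z hz
    have hz' : powVec n z ∈ VS n T := h ▸ Submodule.subset_span (Set.mem_image_of_mem _ hz)
    refine (linearIndepOn_powVec hn (s := T) hT).mem_span_iff.mp hz'
      (linearIndepOn_powVec (k := k) (t := t) hn ?_)
    rintro w (rfl | hw)
    exacts [hS _ hz, hT _ hw]
  exact fun S hS T hT h => (sub S T hS hT h).antisymm (sub T S hT hS h.symm)

theorem VS_nthRootsFinset (hn : 0 < n) (ht : t ≠ 0) :
    VS n (Polynomial.nthRootsFinset n ((-1 : ℂ) ^ (k - 1) * t)) = ⊤ := by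
  apply Submodule.eq_top_of_finrank_eq
  rw [finrank_VS (k := k) (t := t) hn fun z hz => (Polynomial.mem_nthRootsFinset hn _).mp hz,
    card_nthRootsFinset_of_ne_zero hn (by simp [ht]), Module.finrank_fin_fun]

theorem exists_eq_VS_of_map_cycShift_eq (hn : 0 < n) (ht : t ≠ 0)
    {V : Submodule ℂ (Fin n → ℂ)} (hV : Submodule.map (cycShift k n t) V = V) :
    ∃ S : Finset ℂ, (∀ z ∈ S, z ^ n = (-1 : ℂ) ^ (k - 1) * t) ∧ V = VS n S := by
  classical
  set R := Polynomial.nthRootsFinset n ((-1 : ℂ) ^ (k - 1) * t) with hR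
  have hRmem : ∀ z ∈ R, z ^ n = (-1 : ℂ) ^ (k - 1) * t := fun z hz =>
    (Polynomial.mem_nthRootsFinset hn _).mp hz
  refine ⟨{z ∈ R | powVec n z ∈ V}, fun z hz => hRmem z (Finset.mem_filter.mp hz).1,
    le_antisymm (fun v hv => ?_) ?_⟩
  · have hv' : v ∈ VS n R := by rw [hR, VS_nthRootsFinset hn ht]; trivial
    obtain ⟨a, rfl⟩ := (Submodule.mem_span_image_finset_iff_exists_fun' ℂ).mp hv'
    refine Submodule.sum_mem _ fun z hz => ?_
    by_cases ha : a z = 0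
    · simp [ha]
    have hz' := smul_mem_of_sum_smul_mem (e := powVec n) (Submodule.map_le_iff_le_comap.mp hV.le)
      (fun w hw => cycShift_powVec (hRmem w hw)) hv hz
    rw [Submodule.smul_mem_iff _ ha] at hz'
    exact Submodule.smul_mem _ _ (Submodule.subset_span
      (Set.mem_image_of_mem _ (Finset.mem_filter.mpr ⟨hz, hz'⟩)))
  · rw [VS_eq_span, Submodule.span_le]
    rintro _ ⟨z, hz, rfl⟩
    exact (Finset.mem_filter.mp hz).2

end

/-- for `t ≠ 0`, a `k`-dimensional subspace `V ⊆ ℂⁿ` satisfies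
`σ_t(V) = V` iff `V = V_S` for a `k`-element set `S` of `n`-th roots of `(−1)^{k−1}t`;
moreover there are exactly `C(n,k)` such fixed subspaces. -/
theorem deformed_cyclic_shift_fixed (k n : ℕ) (hk : 1 ≤ k) (hkn : k ≤ n)
    (t : ℂ) (ht : t ≠ 0) :
    (∀ V : Submodule ℂ (Fin n → ℂ), Module.finrank ℂ V = k →
        (Submodule.map (cycShift k n t) V = V ↔
          ∃ S : Finset ℂ, S.card = k ∧
            (∀ z ∈ S, z ^ n = (-1 : ℂ) ^ (k - 1) * t) ∧ V = VS n S)) ∧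
      {V : Submodule ℂ (Fin n → ℂ) |
          Module.finrank ℂ V = k ∧ Submodule.map (cycShift k n t) V = V}.ncard
        = Nat.choose n k := by
  have hn : 0 < n := hk.trans hkn
  have main : ∀ V : Submodule ℂ (Fin n → ℂ), Module.finrank ℂ V = k →
      (Submodule.map (cycShift k n t) V = V ↔
        ∃ S : Finset ℂ, S.card = k ∧
          (∀ z ∈ S, z ^ n = (-1 : ℂ) ^ (k - 1) * t) ∧ V = VS n S) := by
    refine fun V hV => ⟨fun h => ?_, ?_⟩
    · obtain ⟨S, hS, rfl⟩ := exists_eq_VS_of_map_cycShift_eq hn ht h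
      exact ⟨S, (finrank_VS hn hS).symm.trans hV, hS, rfl⟩
    · rintro ⟨S, -, hS, rfl⟩
      exact map_cycShift_VS hn ht hS
  refine ⟨main, ?_⟩
  set R := Polynomial.nthRootsFinset n ((-1 : ℂ) ^ (k - 1) * t)
  have hmem : ∀ S : Finset ℂ, S ⊆ R ↔ ∀ z ∈ S, z ^ n = (-1 : ℂ) ^ (k - 1) * t := fun S =>
    forall₂_congr fun z _ => Polynomial.mem_nthRootsFinset hn _
  have himage : {V : Submodule ℂ (Fin n → ℂ) |
      Module.finrank ℂ V = k ∧ Submodule.map (cycShift k n t) V = V} =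
      VS n '' (R.powersetCard k : Set (Finset ℂ)) := by
    ext V
    simp only [Set.mem_ofPred_eq, Set.mem_image, Finset.mem_coe, Finset.mem_powersetCard, hmem]
    constructor
    · rintro ⟨hV, h⟩
      obtain ⟨S, hcard, hS, rfl⟩ := (main V hV).mp h
      exact ⟨S, ⟨hS, hcard⟩, rfl⟩
    · rintro ⟨S, ⟨hS, hcard⟩, rfl⟩
      exact ⟨(finrank_VS hn hS).trans hcard, map_cycShift_VS hn ht hS⟩
  have hinj : Set.InjOn (VS n) (R.powersetCard k : Set (Finset ℂ)) :=
    (VS_injOn hn).mono fun S hS => (hmem S).mp (Finset.mem_powersetCard.mp hS).1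
  rw [himage, hinj.ncard_image, Set.ncard_coe_finset, Finset.card_powersetCard,
    card_nthRootsFinset_of_ne_zero hn (by simp [ht])]
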